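/- Let n, k, m be positive natural numbers with k + m ≤ n, let A be a real (k + m) × n matrix of full row rank, and let W = (W₁, …, W_n) be a vector of independent standard real Gaussian random variables. Set V = A·W ∈ ℝ^{k+m}, write V = (V_A, V_B) with V_A ∈ ℝ^k and V_B ∈ ℝ^m, and let Σ = A·Aᵀ be its covariance matrix, with diagonal blocks Σ_A (the covariance of V_A) and Σ_B (the covariance of V_B). Then the Kullback–Leibler divergence between the joint law of (V_A, V_B) and the product of the laws of V_A and V_B equals (1/2)·ln( det(Σ_A)·det(Σ_B) / det(Σ) ). (This is the general Gaussian mutual-information determinant formula I(V_A; V_B) = log( det Σ_A det Σ_B / det Σ ) used to evaluate I(y(2); z(2t)), I(x(1); z(2t)) and I(x(1); (y(2), z(2t))) in Section IV.) -/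

import Mathlib

open MeasureTheory ProbabilityTheory Matrix
open scoped ENNReal NNReal

/- Kullback–Leibler divergence (in nats) between two measures: `∫ log (dμ/dν) dμ`
when `μ ≪ ν` (and the log-density is integrable), and `+∞` otherwise. -/
open scoped Classical in
noncomputable def klDiv {α : Type*} [MeasurableSpace α] (μ ν : Measure α) : ℝ≥0∞ :=
  if μ ≪ ν ∧ Integrable (fun x => Real.log (μ.rnDeriv ν x).toReal) μ then
    ENNReal.ofReal (∫ x, Real.log (μ.rnDeriv ν x).toReal ∂μ)
  else ⊤

/-- The Lebesgue density of the centered Gaussian law on `ι → ℝ` with covariance matrix `S`. -/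
noncomputable def gaussianDensity {ι : Type*} [Fintype ι] [DecidableEq ι]
    (S : Matrix ι ι ℝ) (x : ι → ℝ) : ℝ :=
  (√(2 * Real.pi))⁻¹ ^ Fintype.card ι * (√S.det)⁻¹ * Real.exp (-(x ⬝ᵥ S⁻¹ *ᵥ x) / 2)

@[fun_prop]
lemma measurable_gaussianDensity {ι : Type*} [Fintype ι] [DecidableEq ι] (S : Matrix ι ι ℝ) :
    Measurable (gaussianDensity S) := by
  unfold gaussianDensity
  apply Continuous.measurable
  fun_prop

lemma gaussianDensity_pos {ι : Type*} [Fintype ι] [DecidableEq ι] {S : Matrix ι ι ℝ}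
    (hS : 0 < S.det) (x : ι → ℝ) : 0 < gaussianDensity S x := by
  unfold gaussianDensity
  positivity

lemma log_gaussianDensity {ι : Type*} [Fintype ι] [DecidableEq ι] {S : Matrix ι ι ℝ}
    (hS : 0 < S.det) (x : ι → ℝ) :
    Real.log (gaussianDensity S x) =
      Fintype.card ι * Real.log (√(2 * Real.pi))⁻¹ - Real.log S.det / 2
        - (x ⬝ᵥ S⁻¹ *ᵥ x) / 2 := by
  unfold gaussianDensity
  rw [Real.log_mul (by positivity) (by positivity), Real.log_mul (by positivity) (by positivity),
    Real.log_exp, Real.log_pow, Real.log_inv (√S.det), Real.log_sqrt hS.le]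
  ring

lemma MeasureTheory.Measure.map_withDensity_measurableEquiv {α β : Type*} [MeasurableSpace α]
    [MeasurableSpace β] (μ : Measure α) (e : α ≃ᵐ β) {f : α → ℝ≥0∞} (hf : Measurable f) :
    (μ.withDensity f).map e = (μ.map e).withDensity (f ∘ e.symm) := by
  ext s hs
  rw [Measure.map_apply e.measurable hs, withDensity_apply _ (e.measurable hs),
    withDensity_apply _ hs, setLIntegral_map hs (hf.comp e.symm.measurable) e.measurable]
  simp

lemma pi_gaussianReal_eq_withDensity (ι : Type*) [Fintype ι] [DecidableEq ι] :
    (Measure.pi fun _ : ι => gaussianReal 0 1) =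
      volume.withDensity fun x => ENNReal.ofReal (gaussianDensity (1 : Matrix ι ι ℝ) x) := by
  have hprod : ∀ x : ι → ℝ,
      gaussianDensity (1 : Matrix ι ι ℝ) x = ∏ i, gaussianPDFReal 0 1 (x i) := by
    intro x
    simp only [gaussianDensity, gaussianPDFReal, Finset.prod_mul_distrib, ← Real.exp_sum]
    simp [dotProduct, ← sq, neg_div, Finset.sum_div]
  apply Measure.pi_eq
  intro s hs
  rw [withDensity_apply _ (MeasurableSet.univ_pi hs), volume_pi, Measure.restrict_pi_pi]
  simp_rw [hprod]
  rw [← ofReal_integral_eq_lintegral_ofReal, integral_fintype_prod_eq_prod,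
    ENNReal.ofReal_prod_of_nonneg]
  · exact Finset.prod_congr rfl fun i _ =>
      (gaussianReal_apply_eq_integral 0 one_ne_zero (s i)).symm
  · exact fun i _ => integral_nonneg fun x => gaussianPDFReal_nonneg 0 1 x
  · exact Integrable.fintype_prod fun i => (integrable_gaussianPDFReal 0 1).restrict
  · exact ae_of_all _ fun x => Finset.prod_nonneg fun i _ => gaussianPDFReal_nonneg 0 1 _

lemma charFunDual_map_mulVec_pi_gaussianReal {ι κ : Type*} [Fintype ι] [Fintype κ]
    [DecidableEq ι] [DecidableEq κ] (A : Matrix ι κ ℝ) (L : StrongDual ℝ (ι → ℝ)) :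
    charFunDual ((Measure.pi fun _ : κ => gaussianReal 0 1).map A.mulVec) L =
      Complex.exp (-((fun i => L (Pi.single i 1)) ⬝ᵥ
        (A * Aᵀ) *ᵥ (fun i => L (Pi.single i 1)) : ℝ) / 2) := by
  have hL : ∀ v, L v = ∑ i, L (Pi.single i 1) * v i := by
    intro v
    conv_lhs => rw [pi_eq_sum_univ' v]
    simp [mul_comm]
  set l : ι → ℝ := fun i => L (Pi.single i 1) with hl
  have hc : ∀ w, L (A *ᵥ w) = ∑ j, w j * (Aᵀ *ᵥ l) j := by
    intro w
    rw [hL]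
    change l ⬝ᵥ A *ᵥ w = w ⬝ᵥ Aᵀ *ᵥ l
    rw [dotProduct_mulVec, dotProduct_comm, mulVec_transpose]
  rw [charFunDual_apply, integral_map (by fun_prop) (by fun_prop)]
  simp_rw [hc, Complex.ofReal_sum, Finset.sum_mul, Complex.exp_sum]
  rw [integral_fintype_prod_eq_prod
    (f := fun j x => Complex.exp (((x * (Aᵀ *ᵥ l) j : ℝ) : ℂ) * Complex.I))]
  have h1 : ∀ c : ℝ, ∫ x : ℝ, Complex.exp (((x * c : ℝ) : ℂ) * Complex.I) ∂gaussianReal 0 1 =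
      Complex.exp (-(c ^ 2 : ℝ) / 2) := by
    intro c
    have := charFun_gaussianReal (μ := 0) (v := 1) c
    rw [charFun_apply_real] at this
    convert this using 2
    · ext x; push_cast; ring_nf
    · push_cast; ring
  simp_rw [h1, ← Complex.exp_sum]
  congr 1
  rw [← Finset.sum_div, Finset.sum_neg_distrib, ← Complex.ofReal_sum, ← mulVec_mulVec,
    dotProduct_mulVec, ← mulVec_transpose]
  simp [dotProduct, sq]

lemma map_mulVec_pi_gaussianReal_congr {ι κ κ' : Type*} [Fintype ι] [Fintype κ] [Fintype κ']
    {A : Matrix ι κ ℝ} {B : Matrix ι κ' ℝ} (h : A * Aᵀ = B * Bᵀ) :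
    (Measure.pi fun _ : κ => gaussianReal 0 1).map A.mulVec =
      (Measure.pi fun _ : κ' => gaussianReal 0 1).map B.mulVec := by
  classical
  have := Measure.isProbabilityMeasure_map (μ := Measure.pi fun _ : κ => gaussianReal 0 1)
    (f := A.mulVec) (by fun_prop)
  have := Measure.isProbabilityMeasure_map (μ := Measure.pi fun _ : κ' => gaussianReal 0 1)
    (f := B.mulVec) (by fun_prop)
  apply Measure.ext_of_charFunDual
  ext L
  rw [charFunDual_map_mulVec_pi_gaussianReal, charFunDual_map_mulVec_pi_gaussianReal, h]

open scoped MatrixOrder Matrix.Norms.L2Operator in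
lemma Matrix.PosSemidef.exists_eq_mul_transpose_self {ι : Type*} [Fintype ι] [DecidableEq ι]
    {S : Matrix ι ι ℝ} (hS : S.PosSemidef) : ∃ R : Matrix ι ι ℝ, S = R * Rᵀ := by
  obtain ⟨y, rfl⟩ := CStarAlgebra.nonneg_iff_eq_star_mul_self.mp hS.nonneg
  exact ⟨yᵀ, by simp [star_eq_conjTranspose]⟩

lemma map_mulVec_pi_gaussianReal_eq_withDensity_of_square {ι : Type*} [Fintype ι] [DecidableEq ι]
    {R : Matrix ι ι ℝ} (hR : R.det ≠ 0) :
    (Measure.pi fun _ : ι => gaussianReal 0 1).map R.mulVec =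
      volume.withDensity fun x => ENNReal.ofReal (gaussianDensity (R * Rᵀ) x) := by
  have hu : IsUnit R.det := isUnit_iff_ne_zero.mpr hR
  let e : (ι → ℝ) ≃ᵐ (ι → ℝ) :=
    { toFun := R.mulVec
      invFun := R⁻¹.mulVec
      left_inv := fun x => by simp [mulVec_mulVec, nonsing_inv_mul _ hu]
      right_inv := fun x => by simp [mulVec_mulVec, mul_nonsing_inv _ hu]
      measurable_toFun := by change Measurable R.mulVec; fun_prop
      measurable_invFun := by change Measurable R⁻¹.mulVec; fun_prop }
  have hmap : (volume : Measure (ι → ℝ)).map e = ENNReal.ofReal |R.det⁻¹| • volume :=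
    Real.map_matrix_volume_pi_eq_smul_volume_pi hR
  change Measure.map e _ = _
  rw [pi_gaussianReal_eq_withDensity,
    Measure.map_withDensity_measurableEquiv _ e (by fun_prop), hmap, withDensity_smul_measure,
    ← withDensity_smul _ (by fun_prop)]
  congr 1
  ext x
  change ENNReal.ofReal _ * ENNReal.ofReal (gaussianDensity 1 (R⁻¹ *ᵥ x)) = _
  rw [← ENNReal.ofReal_mul (abs_nonneg _)]
  congr 1
  simp only [gaussianDensity, det_mul, det_transpose, Real.sqrt_mul_self_eq_abs, det_one,
    Real.sqrt_one, inv_one, one_mulVec, Matrix.mul_inv_rev, abs_inv, ← transpose_nonsing_inv]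
  rw [← mulVec_mulVec x, dotProduct_mulVec x, ← mulVec_transpose, transpose_transpose]
  ring

lemma map_mulVec_pi_gaussianReal_eq_withDensity {ι κ : Type*} [Fintype ι] [Fintype κ]
    [DecidableEq ι] {A : Matrix ι κ ℝ} (hA : (A * Aᵀ).PosDef) :
    (Measure.pi fun _ : κ => gaussianReal 0 1).map A.mulVec =
      volume.withDensity fun x => ENNReal.ofReal (gaussianDensity (A * Aᵀ) x) := by
  obtain ⟨R, hR⟩ := hA.posSemidef.exists_eq_mul_transpose_self
  have hdet : R.det ≠ 0 := by
    intro h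
    have := hA.det_pos
    simp [hR, h] at this
  rw [map_mulVec_pi_gaussianReal_congr hR, hR,
    map_mulVec_pi_gaussianReal_eq_withDensity_of_square hdet]

lemma integral_mul_pi_gaussianReal {κ : Type*} [Fintype κ] [DecidableEq κ] (i j : κ) :
    Integrable (fun w : κ → ℝ => w i * w j) (Measure.pi fun _ => gaussianReal 0 1) ∧
      ∫ w : κ → ℝ, w i * w j ∂(Measure.pi fun _ => gaussianReal 0 1) =
        (1 : Matrix κ κ ℝ) i j := by
  have hmem : ∀ i : κ, MemLp (fun w : κ → ℝ => w i) 2 (Measure.pi fun _ => gaussianReal 0 1) :=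
    fun i => (memLp_id_gaussianReal 2).comp_measurePreserving
      (measurePreserving_eval (fun _ : κ => gaussianReal 0 1) i)
  have hint : ∀ i : κ, ∫ w : κ → ℝ, w i ∂(Measure.pi fun _ => gaussianReal 0 1) = 0 := by
    intro i
    rw [integral_comp_eval (μ := fun _ : κ => gaussianReal 0 1) (f := fun x : ℝ => x)
      (by fun_prop), integral_id_gaussianReal]
  refine ⟨(hmem i).integrable_mul (hmem j), ?_⟩
  by_cases hij : i = j
  · subst hij
    rw [one_apply_eq, integral_comp_eval (μ := fun _ : κ => gaussianReal 0 1)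
      (f := fun x : ℝ => x * x) (by fun_prop)]
    have := variance_fun_id_gaussianReal (μ := 0) (v := 1)
    rw [variance_eq_integral (by fun_prop)] at this
    simpa [integral_id_gaussianReal, sq] using this
  · have hind := (iIndepFun_pi (μ := fun _ : κ => gaussianReal 0 1)
      (X := fun _ x => x) (fun _ => by fun_prop)).indepFun hij
    rw [hind.integral_fun_mul_eq_mul_integral (hmem i).aestronglyMeasurable
      (hmem j).aestronglyMeasurable, hint, hint,
      one_apply_ne hij, zero_mul]

lemma integral_dotProduct_mulVec_pi_gaussianReal {κ : Type*} [Fintype κ] (M : Matrix κ κ ℝ) :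
    Integrable (fun w : κ → ℝ => w ⬝ᵥ M *ᵥ w) (Measure.pi fun _ => gaussianReal 0 1) ∧
      ∫ w : κ → ℝ, w ⬝ᵥ M *ᵥ w ∂(Measure.pi fun _ => gaussianReal 0 1) = M.trace := by
  classical
  have h : ∀ w : κ → ℝ, w ⬝ᵥ M *ᵥ w = ∑ i, ∑ j, M i j * (w i * w j) := by
    intro w
    simp only [dotProduct, mulVec, Finset.mul_sum]
    exact Finset.sum_congr rfl fun i _ => Finset.sum_congr rfl fun j _ => by ring
  simp_rw [h]
  have hi : ∀ i j, Integrable (fun w : κ → ℝ => M i j * (w i * w j))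
      (Measure.pi fun _ => gaussianReal 0 1) :=
    fun i j => (integral_mul_pi_gaussianReal i j).1.const_mul _
  refine ⟨integrable_finsetSum _ fun i _ => integrable_finsetSum _ fun j _ => hi i j, ?_⟩
  rw [integral_finsetSum _ fun i _ => integrable_finsetSum _ fun j _ => hi i j]
  simp_rw [integral_finsetSum _ fun j _ => hi _ j, integral_const_mul,
    (integral_mul_pi_gaussianReal _ _).2]
  simp [trace, one_apply]

lemma integral_mahalanobis_pi_gaussianReal {ι κ : Type*} [Fintype ι] [Fintype κ] [DecidableEq ι]
    {A : Matrix ι κ ℝ} (hA : (A * Aᵀ).PosDef) :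
    Integrable (fun w : κ → ℝ => (A *ᵥ w) ⬝ᵥ (A * Aᵀ)⁻¹ *ᵥ (A *ᵥ w))
        (Measure.pi fun _ => gaussianReal 0 1) ∧
      ∫ w : κ → ℝ, (A *ᵥ w) ⬝ᵥ (A * Aᵀ)⁻¹ *ᵥ (A *ᵥ w) ∂(Measure.pi fun _ => gaussianReal 0 1) =
        Fintype.card ι := by
  have h : ∀ w : κ → ℝ, (A *ᵥ w) ⬝ᵥ (A * Aᵀ)⁻¹ *ᵥ (A *ᵥ w) =
      w ⬝ᵥ (Aᵀ * (A * Aᵀ)⁻¹ * A) *ᵥ w := by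
    intro w
    rw [← mulVec_mulVec, ← mulVec_mulVec, dotProduct_mulVec w, ← mulVec_transpose,
      transpose_transpose]
  simp_rw [h]
  have ht : (Aᵀ * (A * Aᵀ)⁻¹ * A).trace = Fintype.card ι := by
    rw [Matrix.mul_assoc, trace_mul_comm, Matrix.mul_assoc,
      nonsing_inv_mul _ (isUnit_iff_ne_zero.mpr hA.det_pos.ne'), trace_one]
  rw [← ht]
  exact integral_dotProduct_mulVec_pi_gaussianReal _

lemma klDiv_withDensity_withDensity {α : Type*} [MeasurableSpace α] {μ : Measure α}
    [SigmaFinite μ] {f g : α → ℝ} (hf : Measurable f) (hg : Measurable g)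
    (hf0 : ∀ x, 0 < f x) (hg0 : ∀ x, 0 < g x)
    (hint : Integrable (fun x => Real.log (f x / g x))
      (μ.withDensity fun x => ENNReal.ofReal (f x))) :
    klDiv (μ.withDensity fun x => ENNReal.ofReal (f x))
        (μ.withDensity fun x => ENNReal.ofReal (g x)) =
      ENNReal.ofReal (∫ x, Real.log (f x / g x)
        ∂(μ.withDensity fun x => ENNReal.ofReal (f x))) := by
  set P := μ.withDensity fun x => ENNReal.ofReal (f x) with hP
  set Q := μ.withDensity fun x => ENNReal.ofReal (g x) with hQ
  have hPQ : P = Q.withDensity fun x => ENNReal.ofReal (f x / g x) := by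
    rw [hQ, ← withDensity_mul _ (by fun_prop) (by fun_prop), hP]
    congr 1
    ext x
    rw [Pi.mul_apply, ← ENNReal.ofReal_mul (hg0 x).le, mul_div_cancel₀ _ (hg0 x).ne']
  have hac : P ≪ Q := hPQ ▸ withDensity_absolutelyContinuous _ _
  have : SigmaFinite Q := SigmaFinite.withDensity_of_ne_top' fun x => ENNReal.ofReal_ne_top
  have hrn : P.rnDeriv Q =ᵐ[P] fun x => ENNReal.ofReal (f x / g x) := by
    apply hac.ae_le
    change P.rnDeriv Q =ᵐ[Q] _
    rw [hPQ]
    exact Measure.rnDeriv_withDensity Q (by fun_prop)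
  have hlog : (fun x => Real.log (P.rnDeriv Q x).toReal) =ᵐ[P] fun x => Real.log (f x / g x) := by
    filter_upwards [hrn] with x hx
    rw [hx, ENNReal.toReal_ofReal (div_pos (hf0 x) (hg0 x)).le]
  rw [klDiv, if_pos ⟨hac, (integrable_congr hlog).mpr hint⟩, integral_congr_ae hlog]

lemma klDiv_map_prod_pi_gaussianReal {α β κ : Type*} [Fintype α] [Fintype β] [Fintype κ]
    [DecidableEq α] [DecidableEq β] (B : Matrix α κ ℝ) (C : Matrix β κ ℝ)
    (hB : (B * Bᵀ).PosDef) (hC : (C * Cᵀ).PosDef)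
    (hBC : (fromRows B C * (fromRows B C)ᵀ).PosDef) :
    klDiv ((Measure.pi fun _ : κ => gaussianReal 0 1).map fun w => (B *ᵥ w, C *ᵥ w))
        (((Measure.pi fun _ : κ => gaussianReal 0 1).map B.mulVec).prod
          ((Measure.pi fun _ : κ => gaussianReal 0 1).map C.mulVec)) =
      ENNReal.ofReal ((1 / 2) * Real.log
        ((B * Bᵀ).det * (C * Cᵀ).det / (fromRows B C * (fromRows B C)ᵀ).det)) := by
  let e := MeasurableEquiv.sumPiEquivProdPi (fun _ : α ⊕ β => ℝ)
  set S := fromRows B C * (fromRows B C)ᵀ with hS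
  have he : ∀ p : (α → ℝ) × (β → ℝ), e.symm p = Sum.elim p.1 p.2 := by
    intro p
    ext (i | i) <;> rfl
  have hjoint : ((Measure.pi fun _ : κ => gaussianReal 0 1).map fun w => (B *ᵥ w, C *ᵥ w)) =
      (volume : Measure ((α → ℝ) × (β → ℝ))).withDensity
        fun p => ENNReal.ofReal (gaussianDensity S (Sum.elim p.1 p.2)) := by
    have hcomp : (fun w => (B *ᵥ w, C *ᵥ w)) = e ∘ (fromRows B C).mulVec := by
      ext w i <;> rfl
    rw [hcomp, ← Measure.map_map e.measurable (by fun_prop),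
      map_mulVec_pi_gaussianReal_eq_withDensity hBC,
      Measure.map_withDensity_measurableEquiv _ e (by fun_prop),
      (volume_measurePreserving_sumPiEquivProdPi (fun _ : α ⊕ β => ℝ)).map_eq]
    simp only [Function.comp_def, he]
    rfl
  have hprod : (((Measure.pi fun _ : κ => gaussianReal 0 1).map B.mulVec).prod
      ((Measure.pi fun _ : κ => gaussianReal 0 1).map C.mulVec)) =
      (volume : Measure ((α → ℝ) × (β → ℝ))).withDensity fun p =>
        ENNReal.ofReal (gaussianDensity (B * Bᵀ) p.1 * gaussianDensity (C * Cᵀ) p.2) := by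
    rw [map_mulVec_pi_gaussianReal_eq_withDensity hB,
      map_mulVec_pi_gaussianReal_eq_withDensity hC,
      prod_withDensity (by fun_prop) (by fun_prop), Measure.volume_eq_prod]
    congr 1
    ext p
    rw [ENNReal.ofReal_mul (gaussianDensity_pos hB.det_pos _).le]
  have hmeas : Measurable fun p : (α → ℝ) × (β → ℝ) =>
      gaussianDensity S (Sum.elim p.1 p.2) := by
    simp_rw [← he]
    exact (measurable_gaussianDensity S).comp e.symm.measurable
  have hlog : ∀ p : (α → ℝ) × (β → ℝ), Real.log (gaussianDensity S (Sum.elim p.1 p.2) /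
      (gaussianDensity (B * Bᵀ) p.1 * gaussianDensity (C * Cᵀ) p.2)) =
      (1 / 2) * Real.log ((B * Bᵀ).det * (C * Cᵀ).det / S.det) +
        (1 / 2) * (p.1 ⬝ᵥ (B * Bᵀ)⁻¹ *ᵥ p.1 + p.2 ⬝ᵥ (C * Cᵀ)⁻¹ *ᵥ p.2 -
          Sum.elim p.1 p.2 ⬝ᵥ S⁻¹ *ᵥ Sum.elim p.1 p.2) := by
    intro p
    have h1 := hB.det_pos
    have h2 := hC.det_pos
    have h3 := hBC.det_pos
    have h4 := gaussianDensity_pos h1 p.1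
    have h5 := gaussianDensity_pos h2 p.2
    rw [Real.log_div (gaussianDensity_pos h3 _).ne' (by positivity),
      Real.log_mul h4.ne' h5.ne', log_gaussianDensity h1, log_gaussianDensity h2,
      log_gaussianDensity h3, Real.log_div (by positivity) h3.ne', Real.log_mul h1.ne' h2.ne',
      Fintype.card_sum]
    push_cast
    ring
  have hmeaslog : Measurable fun p : (α → ℝ) × (β → ℝ) =>
      Real.log (gaussianDensity S (Sum.elim p.1 p.2) /
        (gaussianDensity (B * Bᵀ) p.1 * gaussianDensity (C * Cᵀ) p.2)) := by
    fun_prop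
  have hpair : Measurable fun w : κ → ℝ => (B *ᵥ w, C *ᵥ w) := by fun_prop
  have hlog_map : ∀ w : κ → ℝ, Real.log (gaussianDensity S (Sum.elim (B *ᵥ w) (C *ᵥ w)) /
      (gaussianDensity (B * Bᵀ) (B *ᵥ w) * gaussianDensity (C * Cᵀ) (C *ᵥ w))) =
      (1 / 2) * Real.log ((B * Bᵀ).det * (C * Cᵀ).det / S.det) +
        (1 / 2) * ((B *ᵥ w) ⬝ᵥ (B * Bᵀ)⁻¹ *ᵥ (B *ᵥ w) + (C *ᵥ w) ⬝ᵥ (C * Cᵀ)⁻¹ *ᵥ (C *ᵥ w) -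
          (fromRows B C *ᵥ w) ⬝ᵥ S⁻¹ *ᵥ (fromRows B C *ᵥ w)) := by
    intro w
    rw [fromRows_mulVec]
    exact hlog (B *ᵥ w, C *ᵥ w)
  obtain ⟨hiB, heB⟩ := integral_mahalanobis_pi_gaussianReal hB
  obtain ⟨hiC, heC⟩ := integral_mahalanobis_pi_gaussianReal hC
  obtain ⟨hiS, heS⟩ := integral_mahalanobis_pi_gaussianReal hBC
  have hint : Integrable (fun p : (α → ℝ) × (β → ℝ) =>
      Real.log (gaussianDensity S (Sum.elim p.1 p.2) /
        (gaussianDensity (B * Bᵀ) p.1 * gaussianDensity (C * Cᵀ) p.2)))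
      ((Measure.pi fun _ : κ => gaussianReal 0 1).map fun w => (B *ᵥ w, C *ᵥ w)) := by
    rw [integrable_map_measure hmeaslog.aestronglyMeasurable hpair.aemeasurable]
    refine (integrable_congr (ae_of_all _ hlog_map)).mpr ?_
    exact (integrable_const _).add (((hiB.fun_add hiC).sub' hiS).const_mul _)
  have hval : ∫ p : (α → ℝ) × (β → ℝ), Real.log (gaussianDensity S (Sum.elim p.1 p.2) /
        (gaussianDensity (B * Bᵀ) p.1 * gaussianDensity (C * Cᵀ) p.2))
      ∂((Measure.pi fun _ : κ => gaussianReal 0 1).map fun w => (B *ᵥ w, C *ᵥ w)) =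
      (1 / 2) * Real.log ((B * Bᵀ).det * (C * Cᵀ).det / S.det) := by
    rw [integral_map hpair.aemeasurable hmeaslog.aestronglyMeasurable]
    refine (integral_congr_ae (ae_of_all _ hlog_map)).trans ?_
    rw [integral_add (integrable_const _) (((hiB.fun_add hiC).sub' hiS).const_mul _),
      integral_const_mul, integral_const_mul, integral_sub (hiB.fun_add hiC) hiS, integral_add hiB hiC, heB, heC, heS]
    simp
  rw [← hval]
  rw [hjoint] at hint ⊢
  rw [hprod]
  exact klDiv_withDensity_withDensity hmeas (by fun_prop)
    (fun p => gaussianDensity_pos hBC.det_pos _)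
    (fun p => mul_pos (gaussianDensity_pos hB.det_pos _) (gaussianDensity_pos hC.det_pos _)) hint

/- Gaussian mutual-information determinant formula: for `V = A·W` with `W` a vector
of `n` i.i.d. standard Gaussians and `A` a full-row-rank `(k+m) × n` matrix, the
mutual information between the first `k` and the last `m` coordinates of `V`
equals `(1/2)·ln(det Σ_A · det Σ_B / det Σ)`, where `Σ = A·Aᵀ` and `Σ_A`, `Σ_B`
are its diagonal blocks. -/
theorem stmt9 (n k m : ℕ) (hn : 0 < n) (hk : 0 < k) (hm : 0 < m) (hkm : k + m ≤ n)
    (A : Matrix (Fin (k + m)) (Fin n) ℝ) (hrank : A.rank = k + m) :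
    klDiv
        ((Measure.pi fun _ : Fin n => gaussianReal 0 1).map
          (fun w => (fun i : Fin k => A.mulVec w (Fin.castAdd m i),
                     fun j : Fin m => A.mulVec w (Fin.natAdd k j))))
        (((Measure.pi fun _ : Fin n => gaussianReal 0 1).map
            (fun w => fun i : Fin k => A.mulVec w (Fin.castAdd m i))).prod
          ((Measure.pi fun _ : Fin n => gaussianReal 0 1).map
            (fun w => fun j : Fin m => A.mulVec w (Fin.natAdd k j)))) =
      ENNReal.ofReal ((1 / 2) * Real.log
        ((((A * Aᵀ).submatrix (Fin.castAdd m) (Fin.castAdd m)).det *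
            ((A * Aᵀ).submatrix (Fin.natAdd k) (Fin.natAdd k)).det) /
          (A * Aᵀ).det)) := by
  have hpd : (A * Aᵀ).PosDef := by
    have hps : (A * Aᵀ).PosSemidef := by simpa using posSemidef_self_mul_conjTranspose A
    refine hps.posDef_iff_isUnit.mpr ?_
    rw [← linearIndependent_rows_iff_isUnit, linearIndependent_iff_card_eq_finrank_span,
      Set.finrank, ← rank_eq_finrank_span_row, rank_self_mul_transpose, hrank, Fintype.card_fin]
  let B : Matrix (Fin k) (Fin n) ℝ := A.submatrix (Fin.castAdd m) id
  let C : Matrix (Fin m) (Fin n) ℝ := A.submatrix (Fin.natAdd k) id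
  have hB : (A * Aᵀ).submatrix (Fin.castAdd m) (Fin.castAdd m) = B * Bᵀ := rfl
  have hC : (A * Aᵀ).submatrix (Fin.natAdd k) (Fin.natAdd k) = C * Cᵀ := rfl
  have hrows : fromRows B C = A.submatrix finSumFinEquiv id := by
    ext (i | i) j <;> simp [B, C]
  have hBC : fromRows B C * (fromRows B C)ᵀ =
      (A * Aᵀ).submatrix finSumFinEquiv finSumFinEquiv := by
    rw [hrows]
    rfl
  rw [hB, hC, ← det_submatrix_equiv_self finSumFinEquiv (A * Aᵀ), ← hBC]
  exact klDiv_map_prod_pi_gaussianReal B C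
    (hB ▸ hpd.submatrix (Fin.castAdd_injective k m))
    (hC ▸ hpd.submatrix (Fin.natAdd_injective m k))
    (hBC ▸ hpd.submatrix finSumFinEquiv.injective)
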